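/- arXiv:0909.1338 — 2 statements merged into one kernel-verified Lean document; each statement's English description precedes it below -/
import Mathlib

section
/- (Multi-Level ROSS, modulation) Let {g_i, h_i}_{i∈{0,1}} be a perfect reconstruction filterbank with finitely supported filters that satisfies the analysis–synthesis symmetry with parameters (a,b). Then for every number of levels L ≥ 1, every bit vector 𝐢 ∈ {0,1}^L with level-0 bit i_0, every x : ℤ → ℝ, and every n ∈ ℤ: v^{x_m}_𝐢[n] = (−1)^{i_0}·w^x_{𝐢′}[n]. -/
open scoped BigOperators

noncomputable section

/-- Discrete convolution `(f ⋆ x)[n] = Σ_m f[m]·x[n−m]` (a finite sum when `f` is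
finitely supported). -/
def conv (f x : ℤ → ℝ) (n : ℤ) : ℝ := ∑ᶠ m : ℤ, f m * x (n - m)

/-- One-level filterbank coefficient `v^x_i[n] = (g_i ⋆ x)[2n]`. -/
def fbCoeff (g x : ℤ → ℝ) (n : ℤ) : ℝ := conv g x (2 * n)

/-- Perfect reconstruction filterbank:
`x[n] = Σ_{i∈{0,1}} Σ_m h_i[n−2m]·v^x_i[m]` for all `x` and `n`. -/
def IsPR (g h : ZMod 2 → ℤ → ℝ) : Prop :=
  ∀ (x : ℤ → ℝ) (n : ℤ),
    x n = ∑ i : ZMod 2, ∑ᶠ m : ℤ, h i (n - 2 * m) * fbCoeff (g i) x m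

/-- Discrete-time Fourier transform `f̂(ω) = Σ_n f[n]·exp(−i·n·ω)`. -/
def dtft (f : ℤ → ℝ) (ω : ℝ) : ℂ :=
  ∑ᶠ n : ℤ, (f n : ℂ) * Complex.exp (-(Complex.I * (n : ℂ) * (ω : ℂ)))

/-- Analysis–synthesis symmetry with parameters `(a, b)`:
`ĝ_i(ω) = (−1)^{1−i}·a·exp(i(2b+1)ω)·ĥ_{1−i}(ω−π)`. -/
def SymmAS (g h : ZMod 2 → ℤ → ℝ) (a : ℝ) (b : ℤ) : Prop :=
  ∀ (i : ZMod 2) (ω : ℝ),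
    dtft (g i) ω
      = (-1 : ℂ) ^ (1 - i : ZMod 2).val * (a : ℂ)
        * Complex.exp (Complex.I * (2 * (b : ℂ) + 1) * (ω : ℂ))
        * dtft (h (1 - i)) (ω - Real.pi)

/-- Complementary analysis filter `g̃_i[n] = a·h_i[n + 2b + 1]`. -/
def compG (a : ℝ) (b : ℤ) (h : ℤ → ℝ) (n : ℤ) : ℝ := a * h (n + (2 * b + 1))

/-- Complementary synthesis filter `h̃_i[n] = a⁻¹·g_i[n − (2b + 1)]`. -/
def compH (a : ℝ) (b : ℤ) (g : ℤ → ℝ) (n : ℤ) : ℝ := a⁻¹ * g (n - (2 * b + 1))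

/-- Modulated sequence `x_m[n] = (−1)^n·x[n]`. -/
def modSeq (x : ℤ → ℝ) (n : ℤ) : ℝ := (-1 : ℝ) ^ n * x n

/-- Subsampled sequence: `x_s[n] = x[n]` for even `n`, and `0` for odd `n`. -/
def subSeq (x : ℤ → ℝ) (n : ℤ) : ℝ := if Even n then x n else 0

/-- Haar analysis filters: `g_i[0] = 1`, `g_i[−1] = (−1)^i`, else `0`. -/
def haarG (i : ZMod 2) (n : ℤ) : ℝ :=
  if n = 0 then 1 else if n = -1 then (-1 : ℝ) ^ i.val else 0

/-- Haar synthesis filters: `h_i[0] = 1/2`, `h_i[1] = (−1)^i/2`, else `0`. -/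
def haarH (i : ZMod 2) (n : ℤ) : ℝ :=
  if n = 0 then 1 / 2 else if n = 1 then (-1 : ℝ) ^ i.val / 2 else 0

/-- `L`-level filterbank coefficients `v^x_𝐢`; the bit `𝐢 0` is the level-0 bit,
applied first, then the remaining levels recursively. -/
def mCoeff (g : ZMod 2 → ℤ → ℝ) : (L : ℕ) → (Fin L → ZMod 2) → (ℤ → ℝ) → ℤ → ℝ
  | 0, _, x => x
  | L + 1, i, x => mCoeff g L (fun t => i t.succ) (fbCoeff (g (i 0)) x)

/-- `L`-level complementary coefficients `w^x_𝐢`: identical to `mCoeff` except that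
the level-0 filter is taken from the complementary bank `gt`. -/
def mCoeffW (g gt : ZMod 2 → ℤ → ℝ) : (L : ℕ) → (Fin L → ZMod 2) → (ℤ → ℝ) → ℤ → ℝ
  | 0, _, x => x
  | L + 1, i, x => mCoeff g L (fun t => i t.succ) (fbCoeff (gt (i 0)) x)

/-- `𝐢′`: flip the level-0 bit of `𝐢`. -/
def flip0 {L : ℕ} (i : Fin (L + 1) → ZMod 2) : Fin (L + 1) → ZMod 2 :=
  Function.update i 0 (1 - i 0)

/-- The character `ω ↦ exp(−i·n·ω)` of the additive group `ℝ`. -/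
def expChar (n : ℤ) : Multiplicative ℝ →* ℂ where
  toFun ω := Complex.exp (-(Complex.I * (n : ℂ) * (ω.toAdd : ℂ)))
  map_one' := by simp
  map_mul' x y := by
    rw [← Complex.exp_add, toAdd_mul]
    push_cast
    ring_nf

theorem expChar_injective : Function.Injective expChar := by
  intro m n hmn
  by_contra hne
  have hc : ((m : ℂ) - n) ≠ 0 := by
    rw [sub_ne_zero]
    exact_mod_cast hne
  have h1 : Complex.exp (-(Complex.I * (m : ℂ) * ((Real.pi / ((m : ℝ) - n) : ℝ) : ℂ)))
      = Complex.exp (-(Complex.I * (n : ℂ) * ((Real.pi / ((m : ℝ) - n) : ℝ) : ℂ))) :=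
    DFunLike.congr_fun hmn (Multiplicative.ofAdd (Real.pi / ((m : ℝ) - n)))
  have h2 : -(Complex.I * (n : ℂ) * ((Real.pi / ((m : ℝ) - n) : ℝ) : ℂ))
      = -(Complex.I * (m : ℂ) * ((Real.pi / ((m : ℝ) - n) : ℝ) : ℂ))
        + Real.pi * Complex.I := by
    push_cast
    field_simp
    ring
  rw [h2, Complex.exp_add, Complex.exp_pi_mul_I] at h1
  have h3 := Complex.exp_ne_zero (-(Complex.I * (m : ℂ) * ((Real.pi / ((m : ℝ) - n) : ℝ) : ℂ)))
  apply h3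
  linear_combination h1 / 2

/-- A finitely supported filter is determined by its discrete-time Fourier transform. -/
theorem eq_of_dtft_eq {f k : ℤ → ℝ} (hf : (Function.support f).Finite)
    (hk : (Function.support k).Finite) (hfk : ∀ ω, dtft f ω = dtft k ω) : f = k := by
  have hli : LinearIndependent ℂ (fun n : ℤ => (expChar n : Multiplicative ℝ → ℂ)) :=
    (linearIndependent_monoidHom (Multiplicative ℝ) ℂ).comp expChar expChar_injective
  have hsum : ∀ (p : ℤ → ℝ) (s : Finset ℤ), Function.support p ⊆ s → ∀ ω, dtft p ω
      = ∑ n ∈ s, (p n : ℂ) * Complex.exp (-(Complex.I * (n : ℂ) * (ω : ℂ))) := by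
    intro p s hs ω
    refine finsum_eq_sum_of_support_subset _ fun n hn => hs ?_
    rw [Function.mem_support] at hn ⊢
    rintro h0
    simp [h0] at hn
  have hs1 : Function.support f ⊆ ((hf.toFinset ∪ hk.toFinset : Finset ℤ) : Set ℤ) := by simp
  have hs2 : Function.support k ⊆ ((hf.toFinset ∪ hk.toFinset : Finset ℤ) : Set ℤ) := by simp
  have hz := linearIndependent_iff'.mp hli (hf.toFinset ∪ hk.toFinset)
    (fun n => (f n : ℂ) - (k n : ℂ)) (by
      funext ω
      have h := hfk ω.toAdd
      rw [hsum f _ hs1, hsum k _ hs2, ← sub_eq_zero, ← Finset.sum_sub_distrib] at h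
      simpa [Finset.sum_apply, expChar, sub_mul] using h)
  funext n
  by_cases hn : n ∈ hf.toFinset ∪ hk.toFinset
  · exact_mod_cast sub_eq_zero.mp (hz n hn)
  · simp only [Finset.mem_union, Set.Finite.mem_toFinset, Function.mem_support, not_or,
      not_not] at hn
    rw [hn.1, hn.2]

theorem support_mul_modSeq_compG_finite (c a : ℝ) (b : ℤ) {h : ℤ → ℝ}
    (hh : (Function.support h).Finite) :
    (Function.support fun n => c * modSeq (compG a b h) n).Finite := by
  refine (hh.preimage (add_left_injective (2 * b + 1)).injOn).subset fun n hn => ?_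
  rw [Set.mem_preimage, Function.mem_support]
  rintro h0
  simp [modSeq, compG, h0] at hn

theorem neg_one_pow_val_one_sub (i : ZMod 2) :
    (-1 : ℂ) ^ (1 - i : ZMod 2).val = -(-1) ^ i.val := by
  obtain rfl | rfl : i = 0 ∨ i = 1 := by revert i; decide
  · simp [ZMod.val_one]
  · simp [ZMod.val_one]

theorem dtft_mul_modSeq_compG (i : ZMod 2) (a : ℝ) (b : ℤ) (h : ℤ → ℝ) (ω : ℝ) :
    dtft (fun n => (-1 : ℝ) ^ i.val * modSeq (compG a b h) n) ω
      = (-1 : ℂ) ^ (1 - i : ZMod 2).val * (a : ℂ)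
        * Complex.exp (Complex.I * (2 * (b : ℂ) + 1) * (ω : ℂ))
        * dtft h (ω - Real.pi) := by
  unfold dtft
  rw [← finsum_comp_equiv (Equiv.addRight (2 * b + 1)) (f := fun n : ℤ => (h n : ℂ) * _),
    ← smul_eq_mul (_ * _ * _), smul_finsum]
  refine finsum_congr fun n => ?_
  have hexp : Complex.exp (-(Complex.I * ((n + (2 * b + 1) : ℤ) : ℂ) * ((ω - Real.pi : ℝ) : ℂ)))
      = Complex.exp (-(Complex.I * (2 * (b : ℂ) + 1) * (ω : ℂ)))
        * Complex.exp (-(Complex.I * (n : ℂ) * (ω : ℂ))) * (-(-1) ^ n) := by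
    have hsign : (-(-1) ^ n : ℂ)
        = Complex.exp (((n + (2 * b + 1) : ℤ) : ℂ) * (Real.pi * Complex.I)) := by
      rw [Complex.exp_int_mul, Complex.exp_pi_mul_I, zpow_add₀ (by norm_num),
        Odd.neg_one_zpow ⟨b, rfl⟩]
      ring
    rw [hsign, ← Complex.exp_add, ← Complex.exp_add]
    congr 1
    push_cast
    ring
  have hcancel : Complex.exp (Complex.I * (2 * (b : ℂ) + 1) * (ω : ℂ))
      * Complex.exp (-(Complex.I * (2 * (b : ℂ) + 1) * (ω : ℂ))) = 1 := by
    rw [← Complex.exp_add, add_neg_cancel, Complex.exp_zero]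
  simp only [Equiv.coe_addRight]
  rw [hexp, neg_one_pow_val_one_sub, smul_eq_mul]
  simp only [modSeq, compG]
  push_cast
  linear_combination (-(-1 : ℂ) ^ i.val * a * h (n + (2 * b + 1)) * (-1) ^ n
    * Complex.exp (-(Complex.I * (n : ℂ) * (ω : ℂ)))) * hcancel

/-- The symmetry in the time domain: `g_i` is, up to sign, the modulation of `g̃_{1−i}`. -/
theorem SymmAS.eq_modSeq_compG {g h : ZMod 2 → ℤ → ℝ} {a : ℝ} {b : ℤ} (hsym : SymmAS g h a b)
    (hg : ∀ i, (Function.support (g i)).Finite) (hh : ∀ i, (Function.support (h i)).Finite)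
    (i : ZMod 2) :
    g i = fun n => (-1 : ℝ) ^ i.val * modSeq (compG a b (h (1 - i))) n :=
  eq_of_dtft_eq (hg i) (support_mul_modSeq_compG_finite _ a b (hh (1 - i))) fun ω => by
    rw [hsym i ω, dtft_mul_modSeq_compG]

theorem fbCoeff_const_mul (f x : ℤ → ℝ) (c : ℝ) :
    fbCoeff f (fun n => c * x n) = fun n => c * fbCoeff f x n := by
  funext n
  simp only [fbCoeff, conv]
  rw [← smul_eq_mul c, smul_finsum]
  exact finsum_congr fun m => by rw [smul_eq_mul]; ring

theorem mCoeff_const_mul (g : ZMod 2 → ℤ → ℝ) (c : ℝ) (L : ℕ) (i : Fin L → ZMod 2)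
    (x : ℤ → ℝ) : mCoeff g L i (fun n => c * x n) = fun n => c * mCoeff g L i x n := by
  induction L generalizing x with
  | zero => rfl
  | succ L ih => simp only [mCoeff, fbCoeff_const_mul, ih]

theorem fbCoeff_modSeq_modSeq (c : ℝ) (f x : ℤ → ℝ) :
    fbCoeff (fun n => c * modSeq f n) (modSeq x) = fun n => c * fbCoeff f x n := by
  funext n
  simp only [fbCoeff, conv, modSeq]
  rw [← smul_eq_mul c, smul_finsum]
  refine finsum_congr fun m => ?_
  have hsign : (-1 : ℝ) ^ m * (-1) ^ (2 * n - m) = 1 := by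
    rw [← zpow_add₀ (by norm_num), add_sub_cancel, Even.neg_one_zpow (even_two_mul n)]
  rw [smul_eq_mul]
  linear_combination (c * f m * x (2 * n - m)) * hsign

/-- Multi-level ROSS (modulation). -/
theorem multilevel_ROSS_modulation (g h : ZMod 2 → ℤ → ℝ)
    (hg : ∀ i : ZMod 2, (Function.support (g i)).Finite)
    (hh : ∀ i : ZMod 2, (Function.support (h i)).Finite)
    (a : ℝ) (b : ℤ) (ha : a ≠ 0)
    (hPR : IsPR g h) (hsym : SymmAS g h a b)
    (L : ℕ) (i : Fin (L + 1) → ZMod 2) (x : ℤ → ℝ) (n : ℤ) :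
    mCoeff g (L + 1) i (modSeq x) n
      = (-1 : ℝ) ^ (i 0).val
        * mCoeffW g (fun k => compG a b (h k)) (L + 1) (flip0 i) x n := by
  simp only [mCoeff, mCoeffW]
  rw [hsym.eq_modSeq_compG hg hh (i 0), fbCoeff_modSeq_modSeq, mCoeff_const_mul]
  simp [flip0]
end
end

section
/- (Multiplicative noise: filterbank-domain decomposition) Let L ≥ 1 and let v^x_𝐢 denote L-level Haar filterbank coefficients indexed by 𝐢 ∈ (ℤ/2ℤ)^L. Let x, ξ : ℤ → ℝ and define y[n] = x[n] + x[n]·ξ[n]. Then for all 𝐢 ∈ (ℤ/2ℤ)^L and n ∈ ℤ: v^y_𝐢[n] = v^x_𝐢[n] + 2^{−L}·Σ_{𝐣∈(ℤ/2ℤ)^L} v^x_{𝐢+𝐣}[n]·v^ξ_𝐣[n]. -/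
open scoped BigOperators

noncomputable section

lemma fbCoeff_haarG (i : ZMod 2) (x : ℤ → ℝ) (n : ℤ) :
    fbCoeff (haarG i) x n = x (2 * n) + (-1 : ℝ) ^ i.val * x (2 * n + 1) := by
  unfold fbCoeff conv
  rw [finsum_eq_sum_of_support_subset (s := {0, -1})]
  · simp [haarG]
  · intro m hm
    by_contra h
    simp only [Finset.coe_insert, Finset.coe_singleton, Set.mem_insert_iff,
      Set.mem_singleton_iff, not_or] at h
    exact hm (by simp [haarG, h.1, h.2])

lemma fbCoeff_haarG_add (i : ZMod 2) (x y : ℤ → ℝ) :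
    fbCoeff (haarG i) (x + y) = fbCoeff (haarG i) x + fbCoeff (haarG i) y := by
  funext n
  simp only [fbCoeff_haarG, Pi.add_apply]
  ring

lemma fbCoeff_haarG_smul (i : ZMod 2) (c : ℝ) (x : ℤ → ℝ) :
    fbCoeff (haarG i) (c • x) = c • fbCoeff (haarG i) x := by
  funext n
  simp only [fbCoeff_haarG, Pi.smul_apply, smul_eq_mul]
  ring

lemma fbCoeff_haarG_mul (i : ZMod 2) (x y : ℤ → ℝ) :
    fbCoeff (haarG i) (x * y)
      = (2 : ℝ)⁻¹ • (fbCoeff (haarG (i + 0)) x * fbCoeff (haarG 0) y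
        + fbCoeff (haarG (i + 1)) x * fbCoeff (haarG 1) y) := by
  have h : (1 + 1 : ZMod 2) = 0 := by decide
  funext n
  simp only [fbCoeff_haarG, Pi.add_apply, Pi.smul_apply, Pi.mul_apply, smul_eq_mul]
  obtain rfl | rfl : i = 0 ∨ i = 1 := by
    revert i
    decide
  all_goals
    simp only [h, add_zero, zero_add, ZMod.val_zero, ZMod.val_one, pow_zero, pow_one]
    ring

lemma mCoeff_haarG_add (L : ℕ) (i : Fin L → ZMod 2) (x y : ℤ → ℝ) :
    mCoeff haarG L i (x + y) = mCoeff haarG L i x + mCoeff haarG L i y := by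
  induction L generalizing x y with
  | zero => rfl
  | succ L ih => simp only [mCoeff, fbCoeff_haarG_add, ih]

lemma mCoeff_haarG_smul (L : ℕ) (i : Fin L → ZMod 2) (c : ℝ) (x : ℤ → ℝ) :
    mCoeff haarG L i (c • x) = c • mCoeff haarG L i x := by
  induction L generalizing x with
  | zero => rfl
  | succ L ih => simp only [mCoeff, fbCoeff_haarG_smul, ih]

lemma mCoeff_haarG_mul (L : ℕ) (i : Fin L → ZMod 2) (x y : ℤ → ℝ) (n : ℤ) :
    mCoeff haarG L i (x * y) n
      = ((2 : ℝ) ^ L)⁻¹ * ∑ j : Fin L → ZMod 2,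
          mCoeff haarG L (i + j) x n * mCoeff haarG L j y n := by
  induction L generalizing x y with
  | zero => simp [mCoeff]
  | succ L ih =>
    rw [← (Fin.consEquiv fun _ : Fin (L + 1) => ZMod 2).sum_comp, Fintype.sum_prod_type]
    have h2 (f : ZMod 2 → ℝ) : ∑ a, f a = f 0 + f 1 := Fin.sum_univ_two f
    rw [h2]
    simp only [mCoeff, fbCoeff_haarG_mul, mCoeff_haarG_add, mCoeff_haarG_smul,
      Pi.add_apply, Pi.smul_apply, smul_eq_mul, ih, Fin.consEquiv_apply,
      Fin.cons_zero, Fin.cons_succ]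
    rw [pow_succ, mul_inv, ← mul_add]
    simp only [Pi.add_def]
    ring

/-- Multiplicative noise: filterbank-domain decomposition. -/
theorem multiplicative_noise_decomposition (L : ℕ) (x ξ : ℤ → ℝ)
    (y : ℤ → ℝ) (hy : ∀ n : ℤ, y n = x n + x n * ξ n)
    (i : Fin (L + 1) → ZMod 2) (n : ℤ) :
    mCoeff haarG (L + 1) i y n
      = mCoeff haarG (L + 1) i x n
        + ((2 : ℝ) ^ (L + 1))⁻¹ * ∑ j : Fin (L + 1) → ZMod 2,
            mCoeff haarG (L + 1) (i + j) x n * mCoeff haarG (L + 1) j ξ n := by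
  obtain rfl : y = x + x * ξ := funext hy
  rw [mCoeff_haarG_add, Pi.add_apply, mCoeff_haarG_mul]
end
end
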